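/- Assume 0 < ε < 1/3. Then for every n ≥ 1, the conditional probability ν({ y : y_0 = 0, y_1 = ⋯ = y_n = 2 }) / ν({ y : y_1 = ⋯ = y_n = 2 }) ≤ C/n with C = p_2² / p_3. In particular the logarithm of this conditional probability tends to −∞ as n → ∞ and is not uniformly bounded from below. -/

import Mathlib

open MeasureTheory Filter Topology
open scoped ENNReal

namespace BitShift

/-- Bi-infinite integer sequences. -/
abbrev Seq := ℤ → ℤ

/-- The bit-shift channel map `φ(x,w)_i = x_i + w_i - w_{i-1}`. -/
def phi (x w : Seq) : Seq := fun i => x i + w i - w (i - 1)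

/-- `x` is a legal source sequence: `x_i ∈ {2,…,k}` for all `i`. -/
def InX (k : ℤ) (x : Seq) : Prop := ∀ i, 2 ≤ x i ∧ x i ≤ k

/-- `w` is a legal jitter sequence: `w_i ∈ {-1,0,1}` for all `i`. -/
def InW (w : Seq) : Prop := ∀ i, w i = -1 ∨ w i = 0 ∨ w i = 1

/-- `m` is the Bernoulli product measure on `ℤ^ℤ` with one-site weights `wt`. -/
def IsBernoulliProd (m : Measure Seq) (wt : ℤ → ℝ≥0∞) : Prop :=
  ∀ (s : Finset ℤ) (f : ℤ → ℤ), m {z | ∀ i ∈ s, z i = f i} = ∏ i ∈ s, wt (f i)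

/-- One-site weights of the source measure `μ`. -/
def srcWt (k : ℤ) (p : ℤ → ℝ≥0∞) : ℤ → ℝ≥0∞ :=
  fun j => if 2 ≤ j ∧ j ≤ k then p j else 0

/-- One-site weights of the jitter measure `π`. -/
noncomputable def jitWt (ε : ℝ≥0∞) : ℤ → ℝ≥0∞ :=
  fun j => if j = 1 ∨ j = -1 then ε else if j = 0 then 1 - 2 * ε else 0


lemma measurableSet_cylinder (s : Finset ℤ) (f : ℤ → ℤ) :
    MeasurableSet {z : Seq | ∀ i ∈ s, z i = f i} := by
  have h : {z : Seq | ∀ i ∈ s, z i = f i} = ⋂ i ∈ s, {z : Seq | z i = f i} := by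
    ext z; simp
  rw [h]
  exact Finset.measurableSet_biInter _ fun i _ =>
    measurableSet_eq_fun (measurable_pi_apply i) measurable_const

lemma measurable_phi : Measurable fun xw : Seq × Seq => phi xw.1 xw.2 := by
  refine measurable_pi_lambda _ fun i => ?_
  unfold phi
  fun_prop

/-- Almost every sequence only takes values of positive weight. -/
lemma IsBernoulliProd.ae_weight_ne_zero {m : Measure Seq} {wt : ℤ → ℝ≥0∞}
    (h : IsBernoulliProd m wt) : ∀ᵐ z ∂m, ∀ i, wt (z i) ≠ 0 := by
  rw [ae_all_iff]
  intro i
  have h0 : ∀ j : ℤ, ∀ᵐ z ∂m, wt j = 0 → z i ≠ j := by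
    intro j
    by_cases hj : wt j = 0
    · have := h {i} fun _ => j
      simp only [Finset.mem_singleton, forall_eq, Finset.prod_singleton, hj] at this
      simpa [ae_iff, hj] using this
    · simp [hj]
  filter_upwards [ae_all_iff.2 h0] with z hz hw
  exact hz _ hw rfl

lemma IsBernoulliProd.ae_inX {m : Measure Seq} {k : ℤ} {p : ℤ → ℝ≥0∞}
    (h : IsBernoulliProd m (srcWt k p)) : ∀ᵐ x ∂m, InX k x := by
  filter_upwards [h.ae_weight_ne_zero] with x hx i
  by_contra hc
  exact hx i (if_neg hc)

lemma IsBernoulliProd.ae_inW {m : Measure Seq} {ε : ℝ≥0∞}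
    (h : IsBernoulliProd m (jitWt ε)) : ∀ᵐ w ∂m, InW w := by
  filter_upwards [h.ae_weight_ne_zero] with w hw i
  by_contra hc
  push Not at hc
  exact hw i (by simp [jitWt, hc])

/-- If `φ(x,w)` is `0` followed by `n` twos, then `w` jumps from `1` to `-1` and stays there. -/
lemma phi_zero_twos_iff {k : ℤ} {x w : Seq} (hx : InX k x) (hw : InW w) (n : ℕ) :
    (phi x w 0 = 0 ∧ ∀ i : ℤ, 1 ≤ i → i ≤ (n : ℤ) → phi x w i = 2) ↔
      (∀ i ∈ Finset.Icc (0 : ℤ) n, x i = 2) ∧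
        ∀ i ∈ Finset.Icc (-1 : ℤ) n, w i = if i = -1 then 1 else -1 := by
  simp only [phi, Finset.mem_Icc]
  constructor
  · rintro ⟨h0, h⟩
    have hm := hw (-1)
    have hx0 := hx 0
    have hw0 := hw 0
    simp only [zero_sub] at h0
    have key : ∀ m : ℕ, m ≤ n → w m = -1 ∧ x m = 2 := by
      intro m
      induction m with
      | zero => intro _; simp only [Nat.cast_zero]; omega
      | succ m ih =>
        intro hm
        have h1 := ih (by omega)
        have h2 := h (m + 1) (by omega) (by omega)
        have h3 := hx (m + 1)
        have h4 := hw (m + 1)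
        rw [add_sub_cancel_right] at h2
        push_cast
        omega
    refine ⟨fun i hi => ?_, fun i hi => ?_⟩
    · obtain ⟨m, rfl⟩ := Int.eq_ofNat_of_zero_le hi.1
      exact (key m (by omega)).2
    · split_ifs with h1
      · subst h1; omega
      · obtain ⟨m, rfl⟩ := Int.eq_ofNat_of_zero_le (show 0 ≤ i by omega)
        exact (key m (by omega)).1
  · rintro ⟨h1, h2⟩
    refine ⟨?_, fun i hi hin => ?_⟩
    · rw [h1 0 (by omega), h2 0 (by omega), h2 (0 - 1) (by omega)]
      norm_num
    · rw [h1 i (by omega), h2 i (by omega), h2 (i - 1) (by omega), if_neg (by omega),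
        if_neg (by omega)]
      norm_num

lemma measure_zero_twos {k : ℤ} (hk : 3 ≤ k) {p : ℤ → ℝ≥0∞} {ε : ℝ≥0∞}
    {μ π : Measure Seq} [IsProbabilityMeasure μ] [IsProbabilityMeasure π]
    (hμ : IsBernoulliProd μ (srcWt k p)) (hπ : IsBernoulliProd π (jitWt ε)) (n : ℕ) :
    ((μ.prod π).map fun xw => phi xw.1 xw.2)
        {y | y 0 = 0 ∧ ∀ i : ℤ, 1 ≤ i → i ≤ (n : ℤ) → y i = 2} =
      p 2 ^ (n + 1) * ε ^ (n + 2) := by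
  have hmeas : MeasurableSet {y : Seq | y 0 = 0 ∧ ∀ i : ℤ, 1 ≤ i → i ≤ (n : ℤ) → y i = 2} := by
    convert measurableSet_cylinder (Finset.Icc 0 (n : ℤ)) (fun i => if i = 0 then 0 else 2)
      using 1
    ext y
    simp only [Set.mem_ofPred_eq, Finset.mem_Icc]
    constructor
    · rintro ⟨h0, h⟩ i hi
      split_ifs with h1
      · rw [h1, h0]
      · exact h i (by omega) hi.2
    · intro h
      exact ⟨by simpa using h 0 (by omega),
        fun i h1 h2 => by rw [h i (by omega), if_neg (by omega)]⟩
  rw [Measure.map_apply measurable_phi hmeas]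
  have hx : ∀ᵐ xw ∂(μ.prod π), InX k xw.1 := Measure.quasiMeasurePreserving_fst.ae hμ.ae_inX
  have hw : ∀ᵐ xw ∂(μ.prod π), InW xw.2 := Measure.quasiMeasurePreserving_snd.ae hπ.ae_inW
  have hae : (fun xw : Seq × Seq => phi xw.1 xw.2) ⁻¹'
      {y | y 0 = 0 ∧ ∀ i : ℤ, 1 ≤ i → i ≤ (n : ℤ) → y i = 2} =ᵐ[μ.prod π]
      {x : Seq | ∀ i ∈ Finset.Icc (0 : ℤ) n, x i = 2} ×ˢ
        {w : Seq | ∀ i ∈ Finset.Icc (-1 : ℤ) n, w i = if i = -1 then 1 else -1} := by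
    filter_upwards [hx, hw] with xw hx hw
    exact propext (phi_zero_twos_iff hx hw n)
  rw [measure_congr hae, Measure.prod_prod, hμ _ fun _ => 2,
    hπ _ fun i => if i = -1 then 1 else -1]
  congr 1
  · have h2 : srcWt k p 2 = p 2 := if_pos ⟨le_rfl, by omega⟩
    rw [Finset.prod_const, h2, Int.card_Icc]
    congr 1
  · have hj : ∀ i ∈ Finset.Icc (-1 : ℤ) n, jitWt ε (if i = -1 then 1 else -1) = ε := by
      intro i _
      split_ifs <;> simp [jitWt]
    rw [Finset.prod_congr rfl hj, Finset.prod_const, Int.card_Icc]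
    congr 1

lemma le_measure_twos {k : ℤ} (hk : 3 ≤ k) {p : ℤ → ℝ≥0∞} {ε : ℝ≥0∞} (hε : ε ≤ 1 - 2 * ε)
    {μ π : Measure Seq} [IsProbabilityMeasure μ] [IsProbabilityMeasure π]
    (hμ : IsBernoulliProd μ (srcWt k p)) (hπ : IsBernoulliProd π (jitWt ε)) (n : ℕ) :
    n * (p 3 * p 2 ^ (n - 1) * ε ^ (n + 1)) ≤
      ((μ.prod π).map fun xw => phi xw.1 xw.2)
        {y | ∀ i : ℤ, 1 ≤ i → i ≤ (n : ℤ) → y i = 2} := by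
  have hmeas : MeasurableSet {y : Seq | ∀ i : ℤ, 1 ≤ i → i ≤ (n : ℤ) → y i = 2} := by
    simpa using measurableSet_cylinder (Finset.Icc 1 (n : ℤ)) (fun _ => 2)
  rw [Measure.map_apply measurable_phi hmeas]
  have h2 : srcWt k p 2 = p 2 := if_pos ⟨le_rfl, by omega⟩
  have h3 : srcWt k p 3 = p 3 := if_pos ⟨by norm_num, hk⟩
  set A : ℤ → Set Seq := fun j => {x | ∀ i ∈ Finset.Icc (1 : ℤ) n, x i = if i = j then 3 else 2}
    with hA
  set B : ℤ → Set Seq := fun j => {w | ∀ i ∈ Finset.Icc (0 : ℤ) n, w i = if i < j then 0 else -1}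
    with hB
  have hμA : ∀ j ∈ Finset.Icc (1 : ℤ) n, μ (A j) = p 3 * p 2 ^ (n - 1) := by
    intro j hj
    rw [hA, hμ _ fun i => if i = j then 3 else 2, ← Finset.mul_prod_erase _ _ hj, if_pos rfl, h3]
    congr 1
    rw [Finset.prod_congr rfl (g := fun _ => p 2)
      (fun i hi => by rw [if_neg (Finset.ne_of_mem_erase hi), h2]),
      Finset.prod_const, Finset.card_erase_of_mem hj, Int.card_Icc]
    simp
  have hπB : ∀ j, ε ^ (n + 1) ≤ π (B j) := by
    intro j
    rw [hB, hπ _ fun i => if i < j then 0 else -1]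
    calc ε ^ (n + 1) = ∏ _i ∈ Finset.Icc (0 : ℤ) n, ε := by
          rw [Finset.prod_const, Int.card_Icc]; congr 1
      _ ≤ _ := by
          refine Finset.prod_le_prod' fun i _ => ?_
          split_ifs
          · simpa [jitWt] using hε
          · simp [jitWt]
  have hdisj : Set.PairwiseDisjoint (↑(Finset.Icc (1 : ℤ) n)) fun j => A j ×ˢ B j := by
    intro a ha b _ hab
    refine Set.disjoint_left.2 fun xw h1 h2 => ?_
    have e1 := h1.1 a ha
    have e2 := h2.1 a ha
    rw [if_pos rfl] at e1
    rw [if_neg hab] at e2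
    omega
  calc n * (p 3 * p 2 ^ (n - 1) * ε ^ (n + 1))
      = ∑ _j ∈ Finset.Icc (1 : ℤ) n, p 3 * p 2 ^ (n - 1) * ε ^ (n + 1) := by
        rw [Finset.sum_const, Int.card_Icc, nsmul_eq_mul]; simp
    _ ≤ ∑ j ∈ Finset.Icc (1 : ℤ) n, (μ.prod π) (A j ×ˢ B j) := by
        refine Finset.sum_le_sum fun j hj => ?_
        rw [Measure.prod_prod, hμA j hj]
        gcongr
        exact hπB j
    _ = (μ.prod π) (⋃ j ∈ Finset.Icc (1 : ℤ) n, A j ×ˢ B j) :=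
        (measure_biUnion_finset hdisj fun j _ =>
          (measurableSet_cylinder _ fun i => if i = j then 3 else 2).prod
            (measurableSet_cylinder _ fun i => if i < j then 0 else -1)).symm
    _ ≤ _ := by
        refine measure_mono (Set.iUnion₂_subset fun j hj => ?_)
        rintro ⟨x, w⟩ ⟨h1, h2⟩ i hi hin
        have e1 := h1 i (Finset.mem_Icc.2 ⟨hi, hin⟩)
        have e2 := h2 i (Finset.mem_Icc.2 ⟨by omega, hin⟩)
        have e3 := h2 (i - 1) (Finset.mem_Icc.2 ⟨by omega, by omega⟩)
        simp only [phi] at e1 e2 e3 ⊢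
        split_ifs at e1 e2 e3 <;> omega

/-- For `ε < 1/3`, the conditional probability
`ν(0 | 2,…,2) ≤ C/n` with `C = p_2²/p_3`; in particular its logarithm tends to `-∞`. -/
theorem condProb_zero_given_twos_le
    (k : ℤ) (hk : 3 ≤ k) (p : ℤ → ℝ≥0∞)
    (hp : ∀ j, 2 ≤ j → j ≤ k → 0 < p j)
    (hpsum : ∑ j ∈ Finset.Icc 2 k, p j = 1)
    (ε : ℝ≥0∞) (hε0 : 0 < ε) (hε : ε < 1 / 3)
    (μ π : Measure Seq) [IsProbabilityMeasure μ] [IsProbabilityMeasure π]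
    (hμ : IsBernoulliProd μ (srcWt k p)) (hπ : IsBernoulliProd π (jitWt ε))
    (ν : Measure Seq) (hν : ν = (μ.prod π).map fun xw => phi xw.1 xw.2) :
    (∀ n : ℕ, 1 ≤ n →
      ν {y | y 0 = 0 ∧ ∀ i : ℤ, 1 ≤ i → i ≤ (n : ℤ) → y i = 2} /
          ν {y | ∀ i : ℤ, 1 ≤ i → i ≤ (n : ℤ) → y i = 2} ≤
        (p 2 ^ 2 / p 3) / (n : ℝ≥0∞)) ∧
    Tendsto
      (fun n : ℕ =>
        Real.log
          ((ν {y | y 0 = 0 ∧ ∀ i : ℤ, 1 ≤ i → i ≤ (n : ℤ) → y i = 2} /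
              ν {y | ∀ i : ℤ, 1 ≤ i → i ≤ (n : ℤ) → y i = 2}).toReal))
      atTop atBot := by
  subst hν
  have hε1 : ε ≤ 1 := hε.le.trans (by simp)
  have hε' : ε ≤ 1 - 2 * ε := by
    refine ENNReal.le_sub_of_add_le_left (by finiteness) ?_
    calc 2 * ε + ε = 3 * ε := by ring
      _ ≤ 3 * (1 / 3) := by gcongr
      _ = 1 := by rw [one_div, ENNReal.mul_inv_cancel (by norm_num) (by norm_num)]
  have hp1 : ∀ j, 2 ≤ j → j ≤ k → p j ≤ 1 := fun j h2 hj =>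
    hpsum ▸ Finset.single_le_sum (f := p) (fun _ _ => zero_le) (Finset.mem_Icc.2 ⟨h2, hj⟩)
  have p2pos := (hp 2 le_rfl (by omega)).ne'
  have p3pos := (hp 3 (by norm_num) hk).ne'
  have p2top : p 2 ≠ ∞ := ne_top_of_le_ne_top ENNReal.one_ne_top (hp1 2 le_rfl (by omega))
  have p3top : p 3 ≠ ∞ := ne_top_of_le_ne_top ENNReal.one_ne_top (hp1 3 (by norm_num) hk)
  have hbound : ∀ n : ℕ, 1 ≤ n →
      ((μ.prod π).map fun xw => phi xw.1 xw.2)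
          {y | y 0 = 0 ∧ ∀ i : ℤ, 1 ≤ i → i ≤ (n : ℤ) → y i = 2} /
        ((μ.prod π).map fun xw => phi xw.1 xw.2)
          {y | ∀ i : ℤ, 1 ≤ i → i ≤ (n : ℤ) → y i = 2} ≤
        (p 2 ^ 2 / p 3) / (n : ℝ≥0∞) := by
    intro n hn
    have hn0 : (n : ℝ≥0∞) ≠ 0 := by exact_mod_cast (by omega : n ≠ 0)
    refine ENNReal.div_le_of_le_mul ?_
    rw [measure_zero_twos hk hμ hπ]
    calc p 2 ^ (n + 1) * ε ^ (n + 2) ≤ p 2 ^ (n + 1) * ε ^ (n + 1) :=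
          mul_le_mul_right (pow_le_pow_of_le_one zero_le hε1 (by omega)) _
      _ = p 2 ^ 2 * p 2 ^ (n - 1) * ε ^ (n + 1) * (p 3 * (p 3)⁻¹) * (n * (n : ℝ≥0∞)⁻¹) := by
          rw [ENNReal.mul_inv_cancel p3pos p3top,
            ENNReal.mul_inv_cancel hn0 (ENNReal.natCast_ne_top n), ← pow_add, mul_one, mul_one]
          congr 2
          omega
      _ = p 2 ^ 2 / p 3 / n * (n * (p 3 * p 2 ^ (n - 1) * ε ^ (n + 1))) := by
          rw [div_eq_mul_inv, div_eq_mul_inv]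
          ring
      _ ≤ _ := mul_le_mul_right (le_measure_twos hk hε' hμ hπ n) _
  refine ⟨hbound, ?_⟩
  have : IsProbabilityMeasure ((μ.prod π).map fun xw => phi xw.1 xw.2) :=
    Measure.isProbabilityMeasure_map measurable_phi.aemeasurable
  have hCtop : p 2 ^ 2 / p 3 ≠ ∞ := ENNReal.div_ne_top (by finiteness) p3pos
  refine Real.tendsto_log_nhdsGT_zero.comp (tendsto_nhdsWithin_iff.2 ⟨?_, ?_⟩)
  · rw [← ENNReal.toReal_zero]
    refine (ENNReal.tendsto_toReal ENNReal.zero_ne_top).comp ?_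
    have hC : Tendsto (fun n : ℕ => p 2 ^ 2 / p 3 / (n : ℝ≥0∞)) atTop (𝓝 0) := by
      simpa [div_eq_mul_inv] using
        ENNReal.Tendsto.const_mul ENNReal.tendsto_inv_nat_nhds_zero (Or.inr hCtop)
    refine tendsto_of_tendsto_of_tendsto_of_le_of_le' tendsto_const_nhds hC
      (Eventually.of_forall fun _ => zero_le) ?_
    filter_upwards [eventually_ge_atTop 1] with n hn using hbound n hn
  · filter_upwards [eventually_ge_atTop 1] with n hn
    refine ENNReal.toReal_pos (ENNReal.div_ne_zero.2 ⟨?_, measure_ne_top _ _⟩) ?_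
    · rw [measure_zero_twos hk hμ hπ]
      exact mul_ne_zero (pow_ne_zero _ p2pos) (pow_ne_zero _ hε0.ne')
    · refine ne_top_of_le_ne_top (ENNReal.div_ne_top hCtop ?_) (hbound n hn)
      exact_mod_cast (by omega : n ≠ 0)

end BitShift
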